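/- arXiv:2008.12591 — 4 statements merged into one kernel-verified Lean document; each statement's English description precedes it below -/
import Mathlib

section
/- Let N ≥ 1 and ℓ ≥ 0 be integers, let I be a downward-closed set of multi-indices, and let i be a multi-index with ∑_{n} i(n) = N + ℓ. Then the set R_i \ I is finite with cardinality at most (1 + ℓ/N)^N (as a real number). -/
/-- A set of multi-indices is downward closed if for every `i ∈ I` and every `n`
with `i n > 1`, the decremented multi-index `i - e_n` belongs to `I`. -/
def DownwardClosed {N : ℕ} (I : Set (Fin N → ℕ)) : Prop :=
  ∀ i ∈ I, ∀ n, 1 < i n → i - Pi.single n 1 ∈ I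

/-- The rectangle `R_i` of multi-indices `j` with `1 ≤ j n ≤ i n` for all `n`. -/
def rect {N : ℕ} (i : Fin N → ℕ) : Set (Fin N → ℕ) :=
  {j | (∀ n, 1 ≤ j n) ∧ ∀ n, j n ≤ i n}

theorem rect_eq_coe_Icc {N : ℕ} (i : Fin N → ℕ) :
    rect i = (Finset.Icc 1 i : Finset (Fin N → ℕ)) := by
  ext j
  simp [rect, Pi.le_def]

theorem ncard_rect {N : ℕ} (i : Fin N → ℕ) : (rect i).ncard = ∏ n, i n := by
  rw [rect_eq_coe_Icc, Set.ncard_coe_finset, Pi.card_Icc]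
  simp

/-- The inequality of arithmetic and geometric means, with natural-number powers. -/
theorem prod_le_sum_div_card_pow {ι : Type*} [Fintype ι] [Nonempty ι] (z : ι → ℝ)
    (hz : ∀ n, 0 ≤ z n) : ∏ n, z n ≤ ((∑ n, z n) / Fintype.card ι) ^ Fintype.card ι := by
  have h := Real.geom_mean_le_arith_mean Finset.univ (fun _ => 1) z (fun _ _ => zero_le_one)
    (by simp [Fintype.card_pos]) (fun n _ => hz n)
  simp only [Real.rpow_one, Finset.sum_const, Finset.card_univ, nsmul_eq_mul, mul_one,
    one_mul] at h
  have hprod : 0 ≤ ∏ n, z n := Finset.prod_nonneg fun n _ => hz n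
  calc ∏ n, z n = ((∏ n, z n) ^ (Fintype.card ι : ℝ)⁻¹) ^ Fintype.card ι :=
        (Real.rpow_inv_natCast_pow hprod Fintype.card_ne_zero).symm
    _ ≤ _ := pow_le_pow_left₀ (Real.rpow_nonneg hprod _) h _

/-- Let `N ≥ 1` and `ℓ ≥ 0` be integers, `I` a downward-closed set
of multi-indices, and `i` a multi-index with `∑ n, i n = N + ℓ`. Then `R_i \ I`
is finite with cardinality at most `(1 + ℓ/N)^N` (as a real number). -/
theorem stmt_4 (N ℓ : ℕ) (hN : 1 ≤ N) (I : Set (Fin N → ℕ))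
    (hImulti : ∀ j ∈ I, ∀ n, 1 ≤ j n) (hI : DownwardClosed I)
    (i : Fin N → ℕ) (hi : ∀ n, 1 ≤ i n) (hsum : ∑ n, i n = N + ℓ) :
    (rect i \ I).Finite ∧
      ((rect i \ I).ncard : ℝ) ≤ (1 + (ℓ : ℝ) / (N : ℝ)) ^ N := by
  have hfin : (rect i).Finite := rect_eq_coe_Icc i ▸ Finset.finite_toSet _
  refine ⟨hfin.subset Set.sdiff_subset, ?_⟩
  have : NeZero N := ⟨by omega⟩
  have hN0 : (N : ℝ) ≠ 0 := NeZero.ne _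
  have hsum' : ∑ n, (i n : ℝ) = N + ℓ := mod_cast hsum
  calc ((rect i \ I).ncard : ℝ) ≤ (rect i).ncard :=
        mod_cast Set.ncard_le_ncard Set.sdiff_subset hfin
    _ = ∏ n, (i n : ℝ) := by rw [ncard_rect, Nat.cast_prod]
    _ ≤ ((∑ n, (i n : ℝ)) / N) ^ N := by
        simpa using prod_le_sum_div_card_pow (fun n => (i n : ℝ)) fun n => Nat.cast_nonneg _
    _ = (1 + (ℓ : ℝ) / (N : ℝ)) ^ N := by rw [hsum', add_div, div_self hN0]
end

section
/- Let i be a multi-index and let I = R_i be the rectangle with opposite vertices 1 and i. Call an element j of the margin M_I maximal if for every k ∈ M_I with k ≠ j there exists n with j(n) > k(n). Then the set of maximal elements of M_I equals { i + e_n : n ∈ Fin N }. -/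
/-- The margin of a set `I` of multi-indices: those multi-indices `i ∉ I` such that
`i - e_n ∈ I` for some `n` with `i n > 1`. -/
def margin {N : ℕ} (I : Set (Fin N → ℕ)) : Set (Fin N → ℕ) :=
  {i | (∀ n, 1 ≤ i n) ∧ i ∉ I ∧ ∃ n, 1 < i n ∧ i - Pi.single n 1 ∈ I}

/-- `j` is maximal in the margin of `I` if for every other element `k` of the
margin there is a direction `n` with `j n > k n`. -/
def MaximalInMargin {N : ℕ} (I : Set (Fin N → ℕ)) (j : Fin N → ℕ) : Prop :=
  j ∈ margin I ∧ ∀ k ∈ margin I, k ≠ j → ∃ n, k n < j n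

/-- An element of the margin of a rectangle exceeds it by one in exactly one direction. -/
theorem mem_margin_rect_iff {N : ℕ} {i j : Fin N → ℕ} (hi : ∀ n, 1 ≤ i n) :
    j ∈ margin (rect i) ↔
      (∀ m, 1 ≤ j m) ∧ ∃ n, j n = i n + 1 ∧ ∀ m, m ≠ n → j m ≤ i m := by
  simp only [margin, rect, Set.mem_ofPred_eq, Pi.sub_apply]
  constructor
  · rintro ⟨h1, hj, n, -, -, hle⟩
    have hne : ∀ m, m ≠ n → j m ≤ i m := fun m hm => by
      simpa [Pi.single_eq_of_ne hm] using hle m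
    refine ⟨h1, n, ?_, hne⟩
    have hn := hle n
    rw [Pi.single_eq_same] at hn
    by_contra hc
    refine hj ⟨h1, fun m => ?_⟩
    by_cases hm : m = n
    · subst hm
      omega
    · exact hne m hm
  · rintro ⟨h1, n, hn, hne⟩
    have hin := hi n
    refine ⟨h1, fun h => by have := h.2 n; omega, n, by omega, fun m => ?_, fun m => ?_⟩ <;>
    · by_cases hm : m = n
      · subst hm
        rw [Pi.single_eq_same]
        omega
      · simpa [Pi.single_eq_of_ne hm] using by first | exact h1 m | exact hne m hm

theorem add_single_mem_margin_rect {N : ℕ} {i : Fin N → ℕ} (hi : ∀ n, 1 ≤ i n) (n : Fin N) :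
    i + Pi.single n 1 ∈ margin (rect i) :=
  (mem_margin_rect_iff hi).2
    ⟨fun m => (hi m).trans (Nat.le_add_right _ _), n, by simp,
      fun m hm => by simp [Pi.single_eq_of_ne hm]⟩

/-- For `I = R_i` a rectangle, the set of maximal elements of the
margin `M_I` equals `{ i + e_n : n ∈ Fin N }`. -/
theorem stmt_5 (N : ℕ) (hN : 1 ≤ N) (i : Fin N → ℕ) (hi : ∀ n, 1 ≤ i n) :
    {j | MaximalInMargin (rect i) j} =
      {j | ∃ n : Fin N, j = i + Pi.single n 1} := by
  ext j
  constructor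
  · rintro ⟨hj, hmax⟩
    obtain ⟨-, n, hn, hne⟩ := (mem_margin_rect_iff hi).1 hj
    refine ⟨n, ?_⟩
    by_contra hc
    obtain ⟨m, hm⟩ := hmax _ (add_single_mem_margin_rect hi n) (Ne.symm hc)
    by_cases hmn : m = n
    · subst hmn
      simp [hn] at hm
    · simp [Pi.single_eq_of_ne hmn] at hm
      exact absurd (hne m hmn) (not_le.2 hm)
  · rintro ⟨n, rfl⟩
    refine ⟨add_single_mem_margin_rect hi n, fun k hk hkne => ?_⟩
    obtain ⟨-, p, hp, hne⟩ := (mem_margin_rect_iff hi).1 hk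
    by_contra! hle
    have hnp : n = p := by
      by_contra hc
      have h1 := hle n
      have h2 := hne n hc
      simp only [Pi.add_apply, Pi.single_eq_same] at h1
      omega
    subst hnp
    refine hkne (funext fun m => ?_)
    by_cases hm : m = n
    · subst hm
      simp [hp]
    · have h1 := hle m
      simp only [Pi.add_apply, Pi.single_eq_of_ne hm, add_zero] at h1 ⊢
      exact le_antisymm (hne m hm) h1
end

section
/- Let I be a finite downward-closed set of multi-indices. Call an element j of the margin M_I maximal if for every k ∈ M_I with k ≠ j there exists n with j(n) > k(n), and let μ_I denote the set of maximal elements of M_I. Then M_I = ⋃_{j ∈ μ_I} (R_j \ I). -/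
theorem DownwardClosed.mem_of_le {N : ℕ} {I : Set (Fin N → ℕ)} (hI : DownwardClosed I)
    {i k : Fin N → ℕ} (hi : i ∈ I) (hk : ∀ n, 1 ≤ k n) (hki : k ≤ i) : k ∈ I := by
  induction i using WellFoundedLT.induction with
  | ind i ih =>
    rcases hki.eq_or_lt with rfl | hlt
    · exact hi
    · obtain ⟨-, n, hn⟩ := Pi.lt_def.1 hlt
      have hin : 1 < i n := (hk n).trans_lt hn
      refine ih (i - Pi.single n 1) ?_ (hI i hi n hin) fun m => ?_
      · refine Pi.lt_def.2 ⟨fun m => Nat.sub_le _ _, n, ?_⟩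
        simp only [Pi.sub_apply, Pi.single_eq_same]
        lia
      · have := hki m
        by_cases hm : m = n
        · subst hm
          simp only [Pi.sub_apply, Pi.single_eq_same]
          lia
        · simpa [Pi.single_eq_of_ne hm] using this

theorem sub_single_add_single {N : ℕ} {i : Fin N → ℕ} {n : Fin N} (hn : 1 < i n) :
    i - Pi.single n 1 + Pi.single n 1 = i := by
  ext m
  by_cases hm : m = n
  · subst hm
    simp only [Pi.add_apply, Pi.sub_apply, Pi.single_eq_same]
    lia
  · simp [Pi.single_eq_of_ne hm]

theorem finite_margin {N : ℕ} {I : Set (Fin N → ℕ)} (hfin : I.Finite) : (margin I).Finite := by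
  refine (Set.finite_iUnion fun n : Fin N => hfin.image (· + Pi.single n 1)).subset ?_
  rintro i ⟨-, -, n, hn, hmem⟩
  exact Set.mem_iUnion.2 ⟨n, _, hmem, sub_single_add_single hn⟩

theorem rect_diff_subset_margin {N : ℕ} {I : Set (Fin N → ℕ)} (hI : DownwardClosed I)
    {j : Fin N → ℕ} (hj : j ∈ margin I) : rect j \ I ⊆ margin I := by
  rintro k ⟨⟨hk, hkj⟩, hkI⟩
  obtain ⟨-, -, n, hn, hmem⟩ := hj
  have hkn : k n = j n := by
    by_contra hne
    refine hkI (hI.mem_of_le hmem hk fun m => ?_)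
    have := hkj m
    by_cases hm : m = n
    · subst hm
      simp only [Pi.sub_apply, Pi.single_eq_same]
      lia
    · simpa [Pi.single_eq_of_ne hm] using this
  refine ⟨hk, hkI, n, hkn ▸ hn, hI.mem_of_le hmem (fun m => ?_)
    fun m => Nat.sub_le_sub_right (hkj m) _⟩
  by_cases hm : m = n
  · subst hm
    simp only [Pi.sub_apply, Pi.single_eq_same]
    lia
  · simpa [Pi.single_eq_of_ne hm] using hk m

/-- For a finite downward-closed set `I` of multi-indices, the
margin is covered by the sets `R_j \ I` for `j` ranging over the maximal
elements `μ_I` of the margin: `M_I = ⋃_{j ∈ μ_I} (R_j \ I)`. -/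
theorem stmt_6 (N : ℕ) (hN : 1 ≤ N) (I : Set (Fin N → ℕ))
    (hImulti : ∀ j ∈ I, ∀ n, 1 ≤ j n) (hI : DownwardClosed I) (hfin : I.Finite) :
    margin I = ⋃ j ∈ {j | MaximalInMargin I j}, (rect j \ I) := by
  apply Set.Subset.antisymm
  · intro i hi
    obtain ⟨j, hij, hj⟩ := (finite_margin hfin).exists_le_maximal hi
    refine Set.mem_biUnion (x := j) ⟨hj.prop, fun k hk hne => ?_⟩ ⟨⟨hi.1, hij⟩, hi.2.1⟩
    by_contra! hjk
    exact hne (hj.eq_of_le hk hjk).symm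
  · exact Set.iUnion₂_subset fun j hj => rect_diff_subset_margin hI hj.1
end

section
/- Let Nc ≥ 1 be an integer and θ ∈ (0, 1] a real number. For each k ∈ Fin Nc let w_k > 0, κ_k > 0 and q_k ∈ (0,1) be real numbers, and let e_k, η_k, e'_k, η'_k ≥ 0 be real numbers. Let K ⊆ Fin Nc be a subset and assume: (reliability) e_k ≤ η_k for all k; (Dörfler marking) θ · ∑_{k} η_k² w_k ≤ ∑_{k ∈ K} η_k² w_k; (contraction on marked indices) e'_k² + κ_k η'_k² ≤ q_k ( e_k² + κ_k η_k² ) for all k ∈ K; (no increase on unmarked indices) e'_k² + κ_k η'_k² ≤ e_k² + κ_k η_k² for all k ∉ K. Set q := 1 + θ · ( max_k (q_k − 1) ) · ( min_k κ_k ) / ( max_k (1 + κ_k) ). Then 0 < q < 1 and ∑_{k} ( e'_k² + κ_k η'_k² ) w_k ≤ q · ∑_{k} ( e_k² + κ_k η_k² ) w_k. -/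
/-- Weighted Dörfler-type reduction of a sum: a decrease by `a * (e² + κ η²)` on the marked
indices `K` yields a decrease by the factor `1 - θ a m / M` overall. -/
theorem sum_le_of_dorfler_marking {ι : Type*} [Fintype ι] {θ a m M : ℝ}
    {w κ e η E : ι → ℝ} {K : Finset ι} (ha : 0 ≤ a) (hm : 0 ≤ m) (hθ : 0 ≤ θ) (hM : 0 < M)
    (hw : ∀ k, 0 ≤ w k) (hmκ : ∀ k, m ≤ κ k) (hκM : ∀ k, 1 + κ k ≤ M)
    (hrel : ∀ k, e k ^ 2 ≤ η k ^ 2)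
    (hdorf : θ * ∑ k, η k ^ 2 * w k ≤ ∑ k ∈ K, η k ^ 2 * w k)
    (hcontr : ∀ k ∈ K, E k ≤ (1 - a) * (e k ^ 2 + κ k * η k ^ 2))
    (hnoinc : ∀ k ∉ K, E k ≤ e k ^ 2 + κ k * η k ^ 2) :
    ∑ k, E k * w k ≤ (1 - θ * a * m / M) * ∑ k, (e k ^ 2 + κ k * η k ^ 2) * w k := by
  classical
  have total_le : ∑ k, (e k ^ 2 + κ k * η k ^ 2) * w k ≤ M * ∑ k, η k ^ 2 * w k := by
    rw [Finset.mul_sum]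
    refine Finset.sum_le_sum fun k _ => ?_
    rw [← mul_assoc]
    refine mul_le_mul_of_nonneg_right ?_ (hw k)
    nlinarith [hrel k, mul_le_mul_of_nonneg_right (hκM k) (sq_nonneg (η k))]
  have decrease : ∑ k, E k * w k ≤
      ∑ k, (e k ^ 2 + κ k * η k ^ 2) * w k - a * m * ∑ k ∈ K, η k ^ 2 * w k := by
    rw [Finset.mul_sum, ← Finset.univ_inter K, ← Finset.sum_ite_mem, ← Finset.sum_sub_distrib]
    refine Finset.sum_le_sum fun k _ => ?_
    split_ifs with hk
    · have h : a * (m * η k ^ 2) ≤ a * (e k ^ 2 + κ k * η k ^ 2) := by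
        refine mul_le_mul_of_nonneg_left ?_ ha
        nlinarith [sq_nonneg (e k), mul_le_mul_of_nonneg_right (hmκ k) (sq_nonneg (η k))]
      have h' : E k ≤ e k ^ 2 + κ k * η k ^ 2 - a * (m * η k ^ 2) := by
        linarith [hcontr k hk]
      linarith [mul_le_mul_of_nonneg_right h' (hw k)]
    · linarith [mul_le_mul_of_nonneg_right (hnoinc k hk) (hw k)]
  have marked := mul_le_mul_of_nonneg_left hdorf (mul_nonneg ha hm)
  have scaled := mul_le_mul_of_nonneg_left total_le
    (div_nonneg (mul_nonneg (mul_nonneg hθ ha) hm) hM.le)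
  rw [← mul_assoc, div_mul_cancel₀ _ hM.ne'] at scaled
  linarith

/-- error-reduction estimate for one iteration of the
finite-element refinement loop over `Nc` collocation points. -/
theorem stmt_14 (Nc : ℕ) (hNc : 1 ≤ Nc) (θ : ℝ) (hθ0 : 0 < θ) (hθ1 : θ ≤ 1)
    (w κ q e η e' η' : Fin Nc → ℝ)
    (hw : ∀ k, 0 < w k) (hκ : ∀ k, 0 < κ k)
    (hq0 : ∀ k, 0 < q k) (hq1 : ∀ k, q k < 1)
    (he : ∀ k, 0 ≤ e k) (hη : ∀ k, 0 ≤ η k)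
    (he' : ∀ k, 0 ≤ e' k) (hη' : ∀ k, 0 ≤ η' k)
    (K : Finset (Fin Nc))
    (hrel : ∀ k, e k ≤ η k)
    (hdorf : θ * ∑ k, (η k) ^ 2 * w k ≤ ∑ k ∈ K, (η k) ^ 2 * w k)
    (hcontr : ∀ k ∈ K,
      (e' k) ^ 2 + κ k * (η' k) ^ 2 ≤ q k * ((e k) ^ 2 + κ k * (η k) ^ 2))
    (hnoinc : ∀ k ∉ K,
      (e' k) ^ 2 + κ k * (η' k) ^ 2 ≤ (e k) ^ 2 + κ k * (η k) ^ 2)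
    (hne : (Finset.univ : Finset (Fin Nc)).Nonempty)
    (Q : ℝ)
    (hQ : Q = 1 + θ * (Finset.univ.sup' hne fun k => q k - 1) *
      (Finset.univ.inf' hne κ) / (Finset.univ.sup' hne fun k => 1 + κ k)) :
    0 < Q ∧ Q < 1 ∧
      ∑ k, ((e' k) ^ 2 + κ k * (η' k) ^ 2) * w k ≤
        Q * ∑ k, ((e k) ^ 2 + κ k * (η k) ^ 2) * w k := by
  set s := Finset.univ.sup' hne fun k => q k - 1
  set m := Finset.univ.inf' hne κ
  set M := Finset.univ.sup' hne fun k => 1 + κ k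
  have hqs : ∀ k, q k - 1 ≤ s := fun k =>
    Finset.le_sup' (fun k => q k - 1) (Finset.mem_univ k)
  have hmκ : ∀ k, m ≤ κ k := fun k => Finset.inf'_le κ (Finset.mem_univ k)
  have hκM : ∀ k, 1 + κ k ≤ M := fun k =>
    Finset.le_sup' (fun k => 1 + κ k) (Finset.mem_univ k)
  have hs : s < 0 := (Finset.sup'_lt_iff hne).2 fun k _ => sub_neg.2 (hq1 k)
  have hm : 0 < m := (Finset.lt_inf'_iff hne).2 fun k _ => hκ k
  have k₀ : Fin Nc := ⟨0, hNc⟩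
  have hs1 : -s < 1 := by linarith [hqs k₀, hq0 k₀]
  have hmM : m < M := by linarith [hmκ k₀, hκM k₀]
  have hM : 0 < M := hm.trans hmM
  have hQ' : Q = 1 - θ * -s * m / M := by rw [hQ]; ring
  have hθs : 0 < θ * -s := mul_pos hθ0 (neg_pos.2 hs)
  have hθs1 : θ * -s < 1 := by nlinarith
  rw [hQ']
  refine ⟨?_, sub_lt_self _ (div_pos (mul_pos hθs hm) hM), ?_⟩
  · rw [sub_pos, div_lt_one hM]
    nlinarith
  · refine sum_le_of_dorfler_marking (neg_pos.2 hs).le hm.le hθ0.le hM (fun k => (hw k).le)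
      hmκ hκM (fun k => pow_le_pow_left₀ (he k) (hrel k) 2) hdorf (fun k hk => ?_) hnoinc
    refine (hcontr k hk).trans (mul_le_mul_of_nonneg_right (by linarith [hqs k]) ?_)
    have := hκ k
    positivity
end
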